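/- For t > 0 let g_t(x,v) = (π²t⁴/3)^{−d/2}exp(−(3|x|²+|3x−2tv|²)/(2t³)) and let Γ_t(x,v) = (x+tv, v). Then ∂_t[(Γ_t g_t)](x,v) = t^{−2d−1} G(t^{−3/2}x, t^{−1/2}v), where G(x,v) := −2d·Γ₁g₁(x,v) − (3/2)·x·∇_x(Γ₁g₁)(x,v) − (1/2)·v·∇_v(Γ₁g₁)(x,v), and consequently for any α, β ≥ 0, integers m, n ≥ 0, and p ∈ [1,∞]², there is a constant C₂ with ‖ |x|^α |v|^β |∇_x^m ∇_v^n ∂_t(Γ_t g_t)(x,v)| ‖_p ≤ C₂ · t^{(3(α−m)+(β−n)−2)/2 − (d/2)(3(1−1/p_x)+(1−1/p_v))} for all t ∈ (0,1]. -/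

import Mathlib

open MeasureTheory Real ENNReal

noncomputable section

/-- The mixed Lebesgue norm ‖f‖_{(p_x,p_v)} on ℝ^d × ℝ^d. -/
def mixedNorm (d : ℕ) (px pv : ℝ≥0∞)
    (f : EuclideanSpace ℝ (Fin d) × EuclideanSpace ℝ (Fin d) → ℝ) : ℝ≥0∞ :=
  eLpNorm (fun v => (eLpNorm (fun x => f (x, v)) px volume).toReal) pv volume

/-- The Gaussian density g_t of (∫₀ᵗ W_s ds, W_t). -/
def kineticGauss (d : ℕ) (t : ℝ) (x v : EuclideanSpace ℝ (Fin d)) : ℝ :=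
  (π ^ 2 * t ^ 4 / 3) ^ (-(d : ℝ) / 2) *
    Real.exp (-(3 * ‖x‖ ^ 2 + ‖(3:ℝ) • x - (2 * t) • v‖ ^ 2) / (2 * t ^ 3))

/-- The sheared kernel (Γ_t g_t)(x,v) = g_t(x + t v, v). -/
def shearedGauss (d : ℕ) (t : ℝ) (x v : EuclideanSpace ℝ (Fin d)) : ℝ :=
  kineticGauss d t (x + t • v) v

/-- G(x,v) = −2d Γ₁g₁(x,v) − (3/2) x·∇_x(Γ₁g₁)(x,v) − (1/2) v·∇_v(Γ₁g₁)(x,v). -/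
def shearedGaussGen (d : ℕ) (x v : EuclideanSpace ℝ (Fin d)) : ℝ :=
  (-(2 * (d:ℝ))) * shearedGauss d 1 x v
    + (-(3:ℝ)/2) * (fderiv ℝ (fun x' => shearedGauss d 1 x' v) x x)
    + (-(1:ℝ)/2) * (fderiv ℝ (fun v' => shearedGauss d 1 x v') v v)

/-- The mixed spatial derivative ∇_x^m ∇_v^n of a function on ℝ^d × ℝ^d, measured in norm. -/
def mixedDerivNorm (d : ℕ) (m n : ℕ)
    (f : EuclideanSpace ℝ (Fin d) → EuclideanSpace ℝ (Fin d) → ℝ)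
    (x v : EuclideanSpace ℝ (Fin d)) : ℝ :=
  ‖iteratedFDeriv ℝ m (fun x' => iteratedFDeriv ℝ n (fun v' => f x' v') v) x‖

open scoped ContDiff SchwartzMap Nat

local notation "EE" d => EuclideanSpace ℝ (Fin d)

/-- The quadratic exponent. -/
def qexp (d : ℕ) (z : (EE d) × (EE d)) : ℝ :=
  -(3 * ‖z.1 + z.2‖ ^ 2 + ‖(3:ℝ) • (z.1 + z.2) - (2:ℝ) • z.2‖ ^ 2) / 2

lemma qexp_temperate (d : ℕ) : (qexp d).HasTemperateGrowth := by
  have h1 : Function.HasTemperateGrowth (fun z : (EE d) × (EE d) => ‖z.1 + z.2‖ ^ 2) :=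
    (Function.hasTemperateGrowth_norm_sq (EE d)).comp
      (ContinuousLinearMap.fst ℝ (EE d) (EE d) + ContinuousLinearMap.snd ℝ (EE d) (EE d)).hasTemperateGrowth
  have h2 : Function.HasTemperateGrowth (fun z : (EE d) × (EE d) =>
      ‖(3:ℝ) • (z.1 + z.2) - (2:ℝ) • z.2‖ ^ 2) :=
    (Function.hasTemperateGrowth_norm_sq (EE d)).comp
      ((3:ℝ) • (ContinuousLinearMap.fst ℝ (EE d) (EE d) + ContinuousLinearMap.snd ℝ (EE d) (EE d))
        - (2:ℝ) • ContinuousLinearMap.snd ℝ (EE d) (EE d)).hasTemperateGrowth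
  have h3 := ((Function.HasTemperateGrowth.const (E := (EE d) × (EE d)) (-3/2 : ℝ)).mul h1).add
    ((Function.HasTemperateGrowth.const (E := (EE d) × (EE d)) (-1/2 : ℝ)).mul h2)
  have h4 : qexp d = ((fun _ => (-3/2 : ℝ)) * (fun z : (EE d) × (EE d) => ‖z.1 + z.2‖ ^ 2)
      + (fun _ => (-1/2 : ℝ)) * (fun z : (EE d) × (EE d) =>
      ‖(3:ℝ) • (z.1 + z.2) - (2:ℝ) • z.2‖ ^ 2)) := by
    funext z
    simp only [qexp, Pi.add_apply, Pi.mul_apply]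
    ring
  rw [h4]
  exact h3

lemma qexp_le (d : ℕ) (z : (EE d) × (EE d)) : qexp d z ≤ -(‖z‖ ^ 2) / 2 := by
  unfold qexp
  set a := z.1 + z.2 with ha
  set b := (3:ℝ) • a - (2:ℝ) • z.2 with hb
  have hv : ‖z.2‖ ≤ (3 * ‖a‖ + ‖b‖) / 2 := by
    have : z.2 = (1/2 : ℝ) • ((3:ℝ) • a - b) := by rw [hb]; module
    rw [this, norm_smul]
    have := norm_sub_le ((3:ℝ) • a) b
    rw [norm_smul] at this
    norm_num at this ⊢
    linarith
  have hx : ‖z.1‖ ≤ (‖a‖ + ‖b‖) / 2 := by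
    have : z.1 = (1/2 : ℝ) • (b - a) := by rw [hb, ha]; module
    rw [this, norm_smul]
    have := norm_sub_le b a
    norm_num at this ⊢
    linarith
  have h : ‖z‖ ^ 2 ≤ 3 * ‖a‖ ^ 2 + ‖b‖ ^ 2 := by
    rcases max_choice ‖z.1‖ ‖z.2‖ with h | h
    · rw [Prod.norm_def, h]
      have := pow_le_pow_left₀ (norm_nonneg _) hx 2
      nlinarith [sq_nonneg (‖a‖ - ‖b‖), sq_nonneg ‖a‖, sq_nonneg ‖b‖]
    · rw [Prod.norm_def, h]
      have := pow_le_pow_left₀ (norm_nonneg _) hv 2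
      nlinarith [sq_nonneg (‖a‖ - ‖b‖), sq_nonneg ‖a‖, sq_nonneg ‖b‖]
  linarith

lemma pow_mul_exp_le (K : ℕ) (r : ℝ) (hr : 0 ≤ r) :
    (1 + r) ^ K * Real.exp (-(r ^ 2) / 2) ≤ K ! * Real.exp (3/2) := by
  have h1 := Real.pow_div_factorial_le_exp (1 + r) (by linarith) K
  rw [div_le_iff₀ (by positivity)] at h1
  have h2 : Real.exp (-(r^2)/2) ≤ Real.exp (1/2 - r) :=
    Real.exp_le_exp.2 (by nlinarith [sq_nonneg (r - 1)])
  calc (1 + r) ^ K * Real.exp (-(r ^ 2) / 2) ≤ (Real.exp (1 + r) * K !) * Real.exp (1/2 - r) := by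
        gcongr
    _ = K ! * (Real.exp (1 + r) * Real.exp (1/2 - r)) := by ring
    _ = _ := by rw [← Real.exp_add]; norm_num

/-- The exponential of the quadratic form as a Schwartz function. -/
def expS (d : ℕ) : 𝓢((EE d) × (EE d), ℝ) where
  toFun := Real.exp ∘ qexp d
  smooth' := Real.contDiff_exp.comp (qexp_temperate d).1
  decay' := by
    intro k n
    obtain ⟨l, C, hC, h⟩ := (qexp_temperate d).norm_iteratedFDeriv_le_uniform n
    refine ⟨n ! * (C + 1) ^ n * ((k + l * n)! * Real.exp (3/2)), fun z => ?_⟩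
    have h1 := norm_iteratedFDeriv_comp_le (n := n) (N := ∞) (Real.contDiff_exp)
      (qexp_temperate d).1 (by exact_mod_cast le_top) z (C := Real.exp (qexp d z))
      (D := (C + 1) * (1 + ‖z‖) ^ l) ?_ ?_
    · have h2 := pow_mul_exp_le (k + l * n) ‖z‖ (norm_nonneg z)
      have h3 : Real.exp (qexp d z) ≤ Real.exp (-(‖z‖ ^ 2) / 2) := Real.exp_le_exp.2 (qexp_le d z)
      calc ‖z‖ ^ k * ‖iteratedFDeriv ℝ n (Real.exp ∘ qexp d) z‖
          ≤ (1 + ‖z‖) ^ k * (n ! * Real.exp (-(‖z‖ ^ 2) / 2) * ((C + 1) * (1 + ‖z‖) ^ l) ^ n) := by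
            gcongr
            · linarith
            · exact h1.trans (by gcongr)
        _ = n ! * (C + 1) ^ n * ((1 + ‖z‖) ^ (k + l * n) * Real.exp (-(‖z‖ ^ 2) / 2)) := by
            rw [pow_add, pow_mul, mul_pow]; ring
        _ ≤ _ := by gcongr
    · intro i _
      rw [norm_iteratedFDeriv_eq_norm_iteratedDeriv, iteratedDeriv_eq_iterate, Real.iter_deriv_exp]
      simp
    · intro i hi hin
      refine (h i hin z).trans ?_
      have h1 : 1 ≤ (C + 1) * (1 + ‖z‖) ^ l :=
        one_le_mul_of_one_le_of_one_le (by linarith) (one_le_pow₀ (by linarith [norm_nonneg z]))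
      calc C * (1 + ‖z‖) ^ l ≤ (C + 1) * (1 + ‖z‖) ^ l := by gcongr; linarith
        _ ≤ _ := le_self_pow₀ h1 (by omega)

lemma expS_apply (d : ℕ) (z) : expS d z = Real.exp (qexp d z) := rfl

/-- `Γ₁g₁` as a Schwartz function. -/
def shS (d : ℕ) : 𝓢((EE d) × (EE d), ℝ) := ((π ^ 2 / 3 : ℝ) ^ (-(d : ℝ) / 2)) • expS d

lemma shS_apply (d : ℕ) (x v : EE d) : shS d (x, v) = shearedGauss d 1 x v := by
  simp [shS, expS_apply, shearedGauss, kineticGauss, qexp]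

/-- the generator coefficient field -/
def genL (d : ℕ) : ((EE d) × (EE d)) →L[ℝ] ((EE d) × (EE d)) :=
  ((-(3:ℝ)/2) • ContinuousLinearMap.fst ℝ (EE d) (EE d)).prod
    ((-(1:ℝ)/2) • ContinuousLinearMap.snd ℝ (EE d) (EE d))

/-- `G` as a Schwartz function. -/
def genS (d : ℕ) : 𝓢((EE d) × (EE d), ℝ) :=
  (-(2 * (d:ℝ))) • shS d +
    SchwartzMap.bilinLeftCLM (𝕜 := ℝ) (ContinuousLinearMap.id ℝ (((EE d) × (EE d)) →L[ℝ] ℝ))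
      (genL d).hasTemperateGrowth (SchwartzMap.fderivCLM ℝ _ _ (shS d))

lemma genS_apply' (d : ℕ) (z) : genS d z =
    (-(2 * (d:ℝ))) * shS d z + fderiv ℝ (shS d) z (genL d z) := by
  rfl

lemma fderiv_shS (d : ℕ) (x v a b : EE d) : fderiv ℝ (shS d) (x, v) (a, b) =
    fderiv ℝ (fun x' => shearedGauss d 1 x' v) x a
     + fderiv ℝ (fun v' => shearedGauss d 1 x v') v b := by
  have hd : HasFDerivAt (shS d) (fderiv ℝ (shS d) (x, v)) (x, v) :=
    ((shS d).differentiableAt).hasFDerivAt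
  have h1 : HasFDerivAt (fun x' => shearedGauss d 1 x' v)
      ((fderiv ℝ (shS d) (x, v)).comp (ContinuousLinearMap.inl ℝ (EE d) (EE d))) x := by
    simp only [← shS_apply]
    exact hd.comp x (hasFDerivAt_prodMk_left x v)
  have h2 : HasFDerivAt (fun v' => shearedGauss d 1 x v')
      ((fderiv ℝ (shS d) (x, v)).comp (ContinuousLinearMap.inr ℝ (EE d) (EE d))) v := by
    simp only [← shS_apply]
    exact hd.comp v (hasFDerivAt_prodMk_right x v)
  rw [h1.fderiv, h2.fderiv]
  simp [← map_add]

lemma genS_apply (d : ℕ) (x v : EE d) : genS d (x, v) = shearedGaussGen d x v := by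
  rw [genS_apply', shearedGaussGen, ← shS_apply]
  have : genL d (x, v) = ((-(3:ℝ)/2) • x, (-(1:ℝ)/2) • v) := rfl
  rw [this, fderiv_shS]
  simp only [map_smul, smul_eq_mul]
  ring

lemma shearedGauss_scale (d : ℕ) (t : ℝ) (ht : 0 < t) (x v : EE d) :
    shearedGauss d t x v =
      t ^ (-(2 * (d:ℝ))) * shS d ((t ^ (-(3:ℝ)/2)) • x, (t ^ (-(1:ℝ)/2)) • v) := by
  rw [shS_apply]
  unfold shearedGauss kineticGauss
  have e1 : t ^ (-(1:ℝ)/2) = t * t ^ (-(3:ℝ)/2) := by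
    rw [← Real.rpow_one_add' ht.le (by norm_num)]; norm_num
  have e2 : (t ^ (-(3:ℝ)/2)) ^ 2 = (t ^ 3)⁻¹ := by
    rw [← Real.rpow_natCast, ← Real.rpow_mul ht.le, ← Real.rpow_natCast t 3, ← Real.rpow_neg ht.le]
    norm_num
  set s := t ^ (-(3:ℝ)/2) with hs
  rw [e1]
  have hspos : 0 < s := by positivity
  have h1 : s • x + (1:ℝ) • (t * s) • v = s • (x + t • v) := by module
  have h2 : (3:ℝ) • (s • (x + t • v)) - (2 * (1:ℝ)) • (t * s) • v =
     s • ((3:ℝ) • (x + t • v) - (2 * t) • v) := by module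
  rw [h1, h2, norm_smul, norm_smul, mul_pow, mul_pow]
  simp only [Real.norm_eq_abs, sq_abs]
  rw [e2, ← mul_assoc]
  congr 1
  · have : π ^ 2 * t ^ 4 / 3 = t ^ (4:ℝ) * (π ^ 2 * 1 ^ 4 / 3) := by
      rw [show (4:ℝ) = ((4:ℕ):ℝ) by norm_num, Real.rpow_natCast]; ring
    rw [this, Real.mul_rpow (by positivity) (by positivity), ← Real.rpow_mul ht.le]
    congr 2
    ring
  · congr 1
    field_simp

lemma deriv_formula (d : ℕ) (t : ℝ) (ht : 0 < t) (x v : EE d) :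
      deriv (fun τ => shearedGauss d τ x v) t
        = t ^ (-(2 * (d:ℝ)) - 1) *
            shearedGaussGen d ((t ^ (-(3:ℝ)/2)) • x) ((t ^ (-(1:ℝ)/2)) • v) := by
  have hev : (fun τ => shearedGauss d τ x v) =ᶠ[nhds t] fun τ =>
      τ ^ (-(2 * (d:ℝ))) * shS d ((τ ^ (-(3:ℝ)/2)) • x, (τ ^ (-(1:ℝ)/2)) • v) := by
    filter_upwards [lt_mem_nhds ht] with τ hτ
    exact shearedGauss_scale d τ hτ x v
  rw [hev.deriv_eq]
  have hp (r : ℝ) : HasDerivAt (fun τ : ℝ => τ ^ r) (r * t ^ (r - 1)) t :=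
    Real.hasDerivAt_rpow_const (Or.inl ht.ne')
  have hc : HasDerivAt (fun τ : ℝ => ((τ ^ (-(3:ℝ)/2)) • x, (τ ^ (-(1:ℝ)/2)) • v))
     (((-(3:ℝ)/2) * t ^ (-(3:ℝ)/2 - 1)) • x, ((-(1:ℝ)/2) * t ^ (-(1:ℝ)/2 - 1)) • v) t :=
    ((hp _).smul_const x).prodMk ((hp _).smul_const v)
  have hd : HasFDerivAt (shS d) (fderiv ℝ (shS d) ((t ^ (-(3:ℝ)/2)) • x, (t ^ (-(1:ℝ)/2)) • v))
      ((t ^ (-(3:ℝ)/2)) • x, (t ^ (-(1:ℝ)/2)) • v) :=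
    ((shS d).differentiableAt).hasFDerivAt
  have hm := (hp (-(2 * (d:ℝ)))).mul (hd.comp_hasDerivAt t hc)
  refine hm.deriv.trans ?_
  rw [← genS_apply, genS_apply']
  have e : ((((-(3:ℝ)/2) * t ^ (-(3:ℝ)/2 - 1)) • x, ((-(1:ℝ)/2) * t ^ (-(1:ℝ)/2 - 1)) • v)
      : (EE d) × (EE d)) = t⁻¹ • genL d ((t ^ (-(3:ℝ)/2)) • x, (t ^ (-(1:ℝ)/2)) • v) := by
    rw [Real.rpow_sub_one ht.ne', Real.rpow_sub_one ht.ne']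
    simp only [genL, ContinuousLinearMap.prod_apply, _root_.smul_apply,
      ContinuousLinearMap.coe_fst', ContinuousLinearMap.coe_snd', Prod.smul_mk, smul_smul]
    congr 2 <;> ring
  rw [e, map_smul, Real.rpow_sub_one ht.ne']
  simp only [Function.comp, smul_eq_mul]
  ring

set_option maxSynthPendingDepth 3 in
lemma norm_iter_iter {E F : Type*} [NormedAddCommGroup E] [NormedSpace ℝ E] [NormedAddCommGroup F] [NormedSpace ℝ F]
    (f : E → F) (n m : ℕ) (x : E) :
    ‖iteratedFDeriv ℝ m (iteratedFDeriv ℝ n f) x‖ = ‖iteratedFDeriv ℝ (m+n) f x‖ := by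
  induction n generalizing m with
  | zero =>
    rw [iteratedFDeriv_zero_eq_comp, LinearIsometryEquiv.norm_iteratedFDeriv_comp_left]; rfl
  | succ n ih =>
    rw [iteratedFDeriv_succ_eq_comp_left, LinearIsometryEquiv.norm_iteratedFDeriv_comp_left, norm_iteratedFDeriv_fderiv, ih, show m + (n + 1) = m + 1 + n by ring]

section partials
variable {E : Type*} [NormedAddCommGroup E] [NormedSpace ℝ E]

lemma partial_v (F : E × E → ℝ) (hF : ContDiff ℝ ∞ F) (n : ℕ) (x v : E) :
    iteratedFDeriv ℝ n (fun v' => F (x, v')) v =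
      ContinuousMultilinearMap.compContinuousLinearMapL
        (fun _ : Fin n => ContinuousLinearMap.inr ℝ E E) (iteratedFDeriv ℝ n F (x, v)) := by
  have h1 : (fun v' => F (x, v')) = (fun z => F ((x, 0) + z)) ∘ ContinuousLinearMap.inr ℝ E E := by
    funext v'; simp
  have h2 : ContDiff ℝ ∞ (fun z => F ((x, 0) + z)) := by fun_prop
  rw [h1, ContinuousLinearMap.iteratedFDeriv_comp_right _ h2 v (by exact_mod_cast le_top),
    iteratedFDeriv_comp_add_left]
  simp

lemma partial_v_contDiff (F : E × E → ℝ) (hF : ContDiff ℝ ∞ F) (n : ℕ) (v : E) :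
    ContDiff ℝ ∞ (fun x => iteratedFDeriv ℝ n (fun v' => F (x, v')) v) := by
  simp_rw [partial_v F hF]
  refine (ContinuousLinearMap.contDiff _).comp ?_
  have : ContDiff ℝ ∞ (iteratedFDeriv ℝ n F) :=
    hF.iteratedFDeriv_right (by exact_mod_cast le_top)
  exact this.comp (by fun_prop)

lemma partial_bound (F : E × E → ℝ) (hF : ContDiff ℝ ∞ F) (m n : ℕ) :
    ∃ K : ℝ, 0 ≤ K ∧ ∀ x v, ‖iteratedFDeriv ℝ m
      (fun x' => iteratedFDeriv ℝ n (fun v' => F (x', v')) v) x‖ ≤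
        K * ‖iteratedFDeriv ℝ (m + n) F (x, v)‖ := by
  set L := ContinuousMultilinearMap.compContinuousLinearMapL (F := ℝ)
        (fun _ : Fin n => ContinuousLinearMap.inr ℝ E E) with hL
  refine ⟨‖L‖ * ∏ _i : Fin m, ‖ContinuousLinearMap.inl ℝ E E‖, by positivity, fun x v => ?_⟩
  simp_rw [partial_v F hF]
  have hD : ContDiff ℝ ∞ (iteratedFDeriv ℝ n F) :=
    hF.iteratedFDeriv_right (by exact_mod_cast le_top)
  have h1 : (fun x' => L (iteratedFDeriv ℝ n F (x', v))) =
      (L ∘ (fun z => iteratedFDeriv ℝ n F ((0, v) + z))) ∘ ContinuousLinearMap.inl ℝ E E := by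
    funext x'; simp
  have h2 : ContDiff ℝ ∞ (fun z => iteratedFDeriv ℝ n F ((0, v) + z)) := by fun_prop
  have h3 : ContDiff ℝ ∞ (L ∘ (fun z => iteratedFDeriv ℝ n F ((0, v) + z))) :=
    L.contDiff.comp h2
  rw [h1, ContinuousLinearMap.iteratedFDeriv_comp_right _ h3 x (by exact_mod_cast le_top)]
  refine (ContinuousMultilinearMap.norm_compContinuousLinearMap_le _ _).trans ?_
  have h4 := L.norm_iteratedFDeriv_comp_left (h2.contDiffAt (x := (x, 0))) (n := m)
    (by exact_mod_cast le_top)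
  rw [iteratedFDeriv_comp_add_left, norm_iter_iter] at h4
  have h5 : ((0, v) + (x, 0) : E × E) = (x, v) := by simp
  rw [h5] at h4
  calc _ ≤ (‖L‖ * ‖iteratedFDeriv ℝ (m + n) F (x, v)‖) *
        ∏ _i : Fin m, ‖ContinuousLinearMap.inl ℝ E E‖ := by
        gcongr
        simpa using h4
    _ = _ := by ring

lemma partial_scale (F : E × E → ℝ) (hF : ContDiff ℝ ∞ F) (m n : ℕ) (a b c : ℝ) (x v : E) :
    iteratedFDeriv ℝ m
      (fun x' => iteratedFDeriv ℝ n (fun v' => c * F (a • x', b • v')) v) x =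
      (c * b ^ n * a ^ m) • iteratedFDeriv ℝ m
      (fun x' => iteratedFDeriv ℝ n (fun v' => F (x', v')) (b • v)) (a • x) := by
  have h1 (x' : E) : iteratedFDeriv ℝ n (fun v' => c * F (a • x', b • v')) v =
      (c * b ^ n) • iteratedFDeriv ℝ n (fun v' => F (a • x', v')) (b • v) := by
    have hs : ContDiff ℝ n (fun v' => F (a • x', v')) :=
      (hF.comp (by fun_prop : ContDiff ℝ ∞ fun v' : E => (a • x', v'))).of_le
        (by exact_mod_cast le_top)
    have hs' : ContDiff ℝ n (fun v' => F (a • x', b • v')) :=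
      hs.comp (contDiff_const_smul b)
    have := iteratedFDeriv_const_smul_apply' (a := c) (x := v) hs'.contDiffAt
    simp only [smul_eq_mul] at this
    rw [this, iteratedFDeriv_comp_const_smul b hs, smul_smul]
  simp_rw [h1]
  have hH : ContDiff ℝ m (fun x' => iteratedFDeriv ℝ n (fun v' => F (x', v')) (b • v)) :=
    (partial_v_contDiff F hF n (b • v)).of_le (by exact_mod_cast le_top)
  have hH' : ContDiff ℝ m
      (fun x' => iteratedFDeriv ℝ n (fun v' => F (a • x', v')) (b • v)) :=
    hH.comp (contDiff_const_smul a)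
  have h2 := iteratedFDeriv_comp_const_smul a hH
  rw [iteratedFDeriv_const_smul_apply' hH'.contDiffAt, h2, smul_smul]

end partials

lemma mixedDeriv_scale (d m n : ℕ) (t : ℝ) (ht : 0 < t) (x v : EE d) :
    mixedDerivNorm d m n (fun x v => deriv (fun τ => shearedGauss d τ x v) t) x v =
      (t ^ (-(2 * (d:ℝ)) - 1) * (t ^ (-(1:ℝ)/2)) ^ n * (t ^ (-(3:ℝ)/2)) ^ m) *
       mixedDerivNorm d m n (shearedGaussGen d) ((t ^ (-(3:ℝ)/2)) • x) ((t ^ (-(1:ℝ)/2)) • v) := by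
  unfold mixedDerivNorm
  simp_rw [deriv_formula d t ht, ← genS_apply]
  rw [partial_scale (genS d) ((genS d).smooth ⊤), norm_smul, Real.norm_of_nonneg (by positivity)]

lemma gen_decay (d m n : ℕ) (α β : ℝ) (hα : 0 ≤ α) (hβ : 0 ≤ β) (k l : ℕ) :
    ∃ K : ℝ, 0 ≤ K ∧ ∀ x v : EE d,
      ‖x‖ ^ α * ‖v‖ ^ β * mixedDerivNorm d m n (shearedGaussGen d) x v ≤
        K * (1 + ‖x‖) ^ (-k : ℝ) * (1 + ‖v‖) ^ (-l : ℝ) := by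
  obtain ⟨K, hK, h⟩ := partial_bound (genS d) ((genS d).smooth ⊤) m n
  set N : ℕ := ⌈α⌉₊ + ⌈β⌉₊ + k + l with hN
  obtain ⟨C, hC⟩ : ∃ C, ∀ z, (1 + ‖z‖) ^ N * ‖iteratedFDeriv ℝ (m + n) (genS d) z‖ ≤ C :=
    ⟨_, fun z => SchwartzMap.one_add_le_sup_seminorm_apply (𝕜 := ℝ) (m := (N, m + n)) le_rfl le_rfl _ z⟩
  have hC0 : 0 ≤ C := le_trans (by positivity) (hC 0)
  refine ⟨K * C, by positivity, fun x v => ?_⟩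
  have hz := hC (x, v)
  set R := 1 + ‖((x, v) : (EE d) × (EE d))‖ with hR
  have hx : ‖x‖ ≤ ‖((x, v) : (EE d) × (EE d))‖ := le_max_left _ _
  have hv : ‖v‖ ≤ ‖((x, v) : (EE d) × (EE d))‖ := le_max_right _ _
  have hx0 := norm_nonneg x
  have hv0 := norm_nonneg v
  have hR1 : 1 ≤ R := by linarith
  have h1 : ‖x‖ ^ α ≤ R ^ ⌈α⌉₊ := by
    rw [← Real.rpow_natCast]
    exact (Real.rpow_le_rpow hx0 (by linarith) hα).trans
      (Real.rpow_le_rpow_of_exponent_le hR1 (Nat.le_ceil α))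
  have h2 : ‖v‖ ^ β ≤ R ^ ⌈β⌉₊ := by
    rw [← Real.rpow_natCast]
    exact (Real.rpow_le_rpow hv0 (by linarith) hβ).trans
      (Real.rpow_le_rpow_of_exponent_le hR1 (Nat.le_ceil β))
  have h3 : mixedDerivNorm d m n (shearedGaussGen d) x v ≤
      K * ‖iteratedFDeriv ℝ (m + n) (genS d) (x, v)‖ := by
    have := h x v
    simp only [genS_apply] at this
    exact this
  have h4 : 0 ≤ mixedDerivNorm d m n (shearedGaussGen d) x v := norm_nonneg _
  rw [Real.rpow_neg (by linarith), Real.rpow_neg (by linarith), Real.rpow_natCast,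
    Real.rpow_natCast, ← div_eq_mul_inv, ← div_eq_mul_inv, div_div, le_div_iff₀ (by positivity)]
  calc _ ≤ R ^ ⌈α⌉₊ * R ^ ⌈β⌉₊ * (K * ‖iteratedFDeriv ℝ (m + n) (genS d) (x, v)‖) *
        (R ^ k * R ^ l) := by gcongr <;> linarith
    _ = K * (R ^ N * ‖iteratedFDeriv ℝ (m + n) (genS d) (x, v)‖) := by
        rw [hN]; simp only [pow_add]; ring
    _ ≤ K * C := by gcongr

lemma eLpNorm_dilate (d : ℕ) (p : ℝ≥0∞) (hp : 1 ≤ p) (a : ℝ) (ha : 0 < a) (f : (EE d) → ℝ) :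
    eLpNorm (fun x => f (a • x)) p volume =
      ENNReal.ofReal (a ^ (-(d:ℝ) * (1 - (1 - 1/p).toReal))) * eLpNorm f p volume := by
  have he : MeasurableEmbedding (fun x : EE d => a • x) :=
    (Homeomorph.smulOfNeZero a ha.ne').measurableEmbedding
  have h1 := he.eLpNorm_map_measure (g := f) (p := p) (μ := volume)
  rw [Measure.map_addHaar_smul _ ha.ne', eLpNorm_smul_measure_of_ne_zero] at h1
  · refine Eq.trans h1.symm ?_
    rw [smul_eq_mul]
    congr 1
    have e : (1 - (1 - 1/p).toReal) = (1/p).toReal := by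
      rw [ENNReal.toReal_sub_of_le (by simpa using hp) (by simp)]; simp
    rw [e, finrank_euclideanSpace_fin, abs_of_pos (by positivity),
      ENNReal.ofReal_rpow_of_nonneg (by positivity) (by positivity)]
    congr 1
    rw [Real.rpow_mul ha.le, Real.rpow_neg ha.le, Real.rpow_natCast]
  · have : 0 < |(a ^ Module.finrank ℝ (EE d))⁻¹| := by positivity
    simpa using this

lemma mixedNorm_dilate (d : ℕ) (px pv : ℝ≥0∞) (hpx : 1 ≤ px) (hpv : 1 ≤ pv) (a b c : ℝ)
    (ha : 0 < a) (hb : 0 < b) (hc : 0 < c) (F : (EE d) × (EE d) → ℝ) :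
    mixedNorm d px pv (fun z => c * F (a • z.1, b • z.2)) =
      ENNReal.ofReal (c * a ^ (-(d:ℝ) * (1 - (1 - 1/px).toReal))
        * b ^ (-(d:ℝ) * (1 - (1 - 1/pv).toReal))) * mixedNorm d px pv F := by
  have hconst (p : ℝ≥0∞) (r : ℝ) (hr : 0 < r) (f : (EE d) → ℝ) :
      eLpNorm (fun x => r * f x) p volume = ENNReal.ofReal r * eLpNorm f p volume := by
    have := eLpNorm_const_smul r f p (volume : Measure (EE d))
    rw [Real.enorm_of_nonneg hr.le] at this
    exact this
  unfold mixedNorm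
  have h1 (v : EE d) : (eLpNorm (fun x => c * F (a • x, b • v)) px volume).toReal =
      (c * a ^ (-(d:ℝ) * (1 - (1 - 1/px).toReal))) *
        (eLpNorm (fun x => F (x, b • v)) px volume).toReal := by
    rw [hconst px c hc, eLpNorm_dilate d px hpx a ha (fun x => F (x, b • v)), ← mul_assoc,
      ← ENNReal.ofReal_mul hc.le, ENNReal.toReal_mul, ENNReal.toReal_ofReal (by positivity)]
  simp only [h1]
  rw [hconst pv _ (by positivity),
    eLpNorm_dilate d pv hpv b hb (fun v => (eLpNorm (fun x => F (x, v)) px volume).toReal),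
    ← mul_assoc, ← ENNReal.ofReal_mul (by positivity)]

lemma mixedNorm_gen_lt_top (d m n : ℕ) (α β : ℝ) (hα : 0 ≤ α) (hβ : 0 ≤ β) (px pv : ℝ≥0∞) :
    mixedNorm d px pv (fun z => ‖z.1‖ ^ α * ‖z.2‖ ^ β *
      mixedDerivNorm d m n (shearedGaussGen d) z.1 z.2) < ⊤ := by
  obtain ⟨k, hk⟩ := Measure.HasTemperateGrowth.exists_eLpNorm_lt_top px
    (inferInstance : (volume : Measure (EE d)).HasTemperateGrowth)
  obtain ⟨l, hl⟩ := Measure.HasTemperateGrowth.exists_eLpNorm_lt_top pv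
    (inferInstance : (volume : Measure (EE d)).HasTemperateGrowth)
  obtain ⟨K, hK, h⟩ := gen_decay d m n α β hα hβ k l
  set A := eLpNorm (fun x : EE d => (1 + ‖x‖) ^ (-k : ℝ)) px volume with hA
  have hin (v : EE d) : (eLpNorm (fun x : EE d => ‖x‖ ^ α * ‖v‖ ^ β *
      mixedDerivNorm d m n (shearedGaussGen d) x v) px volume).toReal ≤
        (K * A.toReal) * (1 + ‖v‖) ^ (-l : ℝ) := by
    have h1 : eLpNorm (fun x : EE d => ‖x‖ ^ α * ‖v‖ ^ β *
      mixedDerivNorm d m n (shearedGaussGen d) x v) px volume ≤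
        ENNReal.ofReal (K * (1 + ‖v‖) ^ (-l : ℝ)) * A := by
      refine eLpNorm_le_mul_eLpNorm_of_ae_le_mul (Filter.Eventually.of_forall fun x => ?_) px
      have h4 : 0 ≤ mixedDerivNorm d m n (shearedGaussGen d) x v := norm_nonneg _
      rw [Real.norm_of_nonneg (by positivity), Real.norm_of_nonneg (by positivity)]
      refine (h x v).trans (le_of_eq (by ring))
    refine (ENNReal.toReal_mono (ENNReal.mul_ne_top ENNReal.ofReal_ne_top hk.ne) h1).trans ?_
    rw [ENNReal.toReal_mul, ENNReal.toReal_ofReal (by positivity)]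
    exact le_of_eq (by ring)
  unfold mixedNorm
  refine lt_of_le_of_lt (eLpNorm_le_mul_eLpNorm_of_ae_le_mul (c := K * A.toReal)
    (g := fun v : EE d => (1 + ‖v‖) ^ (-l : ℝ))
    (Filter.Eventually.of_forall fun v => ?_) pv) (ENNReal.mul_lt_top ENNReal.ofReal_lt_top hl)
  rw [Real.norm_of_nonneg (by positivity), Real.norm_of_nonneg (by positivity)]
  exact hin v

/-- Time derivative identity and weighted mixed-norm bound for ∂_t(Γ_t g_t). -/
theorem shearedGauss_deriv_scaling_and_bound (d : ℕ) :
    (∀ t : ℝ, 0 < t → ∀ x v : EuclideanSpace ℝ (Fin d),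
      deriv (fun τ => shearedGauss d τ x v) t
        = t ^ (-(2 * (d:ℝ)) - 1) *
            shearedGaussGen d ((t ^ (-(3:ℝ)/2)) • x) ((t ^ (-(1:ℝ)/2)) • v)) ∧
    (∀ (α β : ℝ), 0 ≤ α → 0 ≤ β → ∀ (m n : ℕ) (px pv : ℝ≥0∞), 1 ≤ px → 1 ≤ pv →
      ∃ C : ℝ, 0 ≤ C ∧ ∀ t : ℝ, t ∈ Set.Ioc (0:ℝ) 1 →
        mixedNorm d px pv
            (fun z => ‖z.1‖ ^ α * ‖z.2‖ ^ β *
              mixedDerivNorm d m n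
                (fun x v => deriv (fun τ => shearedGauss d τ x v) t) z.1 z.2)
          ≤ ENNReal.ofReal
              (C * t ^ ((3 * (α - (m:ℝ)) + (β - (n:ℝ)) - 2) / 2
                  - ((d:ℝ)/2) * (3 * (1 - 1/px).toReal + (1 - 1/pv).toReal)))) := by
  refine ⟨fun t ht x v => deriv_formula d t ht x v, fun α β hα hβ m n px pv hpx hpv => ?_⟩
  refine ⟨(mixedNorm d px pv (fun z => ‖z.1‖ ^ α * ‖z.2‖ ^ β *
    mixedDerivNorm d m n (shearedGaussGen d) z.1 z.2)).toReal, by positivity, fun t ht => ?_⟩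
  have ht0 : 0 < t := ht.1
  have hfin := mixedNorm_gen_lt_top d m n α β hα hβ px pv
  set M := mixedNorm d px pv (fun z => ‖z.1‖ ^ α * ‖z.2‖ ^ β *
    mixedDerivNorm d m n (shearedGaussGen d) z.1 z.2) with hM
  have hfun : (fun z : (EE d) × (EE d) => ‖z.1‖ ^ α * ‖z.2‖ ^ β *
              mixedDerivNorm d m n
                (fun x v => deriv (fun τ => shearedGauss d τ x v) t) z.1 z.2) =
      fun z => (t ^ (-(2 * (d:ℝ)) - 1 + (3 * (α - m) + (β - n)) / 2)) *
        (fun z : (EE d) × (EE d) => ‖z.1‖ ^ α * ‖z.2‖ ^ β *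
          mixedDerivNorm d m n (shearedGaussGen d) z.1 z.2)
          ((t ^ (-(3:ℝ)/2)) • z.1, (t ^ (-(1:ℝ)/2)) • z.2) := by
    funext z
    rw [mixedDeriv_scale d m n t ht0]
    simp only [norm_smul]
    rw [Real.norm_of_nonneg (by positivity), Real.norm_of_nonneg (by positivity),
      Real.mul_rpow (by positivity) (by positivity), Real.mul_rpow (by positivity) (by positivity)]
    have e : t ^ (-(2 * (d:ℝ)) - 1) * (t ^ (-(1:ℝ)/2)) ^ n * (t ^ (-(3:ℝ)/2)) ^ m =
        t ^ (-(2 * (d:ℝ)) - 1 + (3 * (α - m) + (β - n)) / 2) *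
          ((t ^ (-(3:ℝ)/2)) ^ α * (t ^ (-(1:ℝ)/2)) ^ β) := by
      simp only [← Real.rpow_natCast, ← Real.rpow_mul ht0.le, ← Real.rpow_add ht0]
      congr 1
      ring
    rw [e]
    ring
  rw [hfun, mixedNorm_dilate d px pv hpx hpv (t ^ (-(3:ℝ)/2)) (t ^ (-(1:ℝ)/2))
      (t ^ (-(2 * (d:ℝ)) - 1 + (3 * (α - m) + (β - n)) / 2))
      (by positivity) (by positivity) (by positivity) (fun z : (EE d) × (EE d) =>
        ‖z.1‖ ^ α * ‖z.2‖ ^ β * mixedDerivNorm d m n (shearedGaussGen d) z.1 z.2),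
    ← hM]
  conv_lhs => rw [← ENNReal.ofReal_toReal hfin.ne]
  rw [← ENNReal.ofReal_mul (by positivity), mul_comm]
  refine le_of_eq ?_
  congr 2
  simp only [← Real.rpow_mul ht0.le, ← Real.rpow_add ht0]
  congr 1
  ring
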